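/- Let m ≥ 6 be even and n ≥ 5 be odd, let G = C_m × C_n with vertices v_{ij} (i ∈ Z/m, j ∈ Z/n), and let M be a 3-matching of G. If there exists j such that the subgraph G' induced by the two consecutive columns T_j ∪ T_{j+1} contains exactly one or exactly two edges of M and no edge of M has one end in G' and the other end in G − V(G'), then M is contained in a perfect matching of G. -/

import Mathlib

open SimpleGraph

/-- A set of edges of `G` forming a matching: pairwise disjoint edges of `G`. -/
def IsMatchingSet {V : Type*} (G : SimpleGraph V) (M : Set (Sym2 V)) : Prop :=
  M ⊆ G.edgeSet ∧ M.Pairwise fun e f => ∀ v, v ∈ e → v ∉ f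

/-- A perfect matching of `G`: a matching covering every vertex. -/
def IsPerfectMatchingSet {V : Type*} (G : SimpleGraph V) (M : Set (Sym2 V)) : Prop :=
  IsMatchingSet G M ∧ ∀ v : V, ∃ e ∈ M, v ∈ e

/-- `G` is `k`-extendable: it has a perfect matching, and every `k`-matching
extends to a perfect matching. -/
def Extendable {V : Type*} (G : SimpleGraph V) (k : ℕ) : Prop :=
  (∃ P, IsPerfectMatchingSet G P) ∧
    ∀ M : Set (Sym2 V), IsMatchingSet G M → M.ncard = k →
      ∃ P, IsPerfectMatchingSet G P ∧ M ⊆ P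

/-- The cycle graph on `n` vertices, with vertex set `ZMod n`. -/
def cycleZMod (n : ℕ) : SimpleGraph (ZMod n) :=
  SimpleGraph.fromRel fun a b => b = a + 1

/-- Some matching of `G` contains `F` and covers precisely the vertices of `S`. -/
def MatchesOn {V : Type*} (G : SimpleGraph V) (S : Set V) (F : Set (Sym2 V)) : Prop :=
  ∃ P, IsMatchingSet G P ∧ F ⊆ P ∧ ∀ v, (∃ e ∈ P, v ∈ e) ↔ v ∈ S

lemma matchesOn_of_involution {V : Type*} {G : SimpleGraph V} {S : Set V} {F : Set (Sym2 V)}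
    (σ : V → V) (hS : ∀ v ∈ S, σ v ∈ S) (hσ : ∀ v ∈ S, σ (σ v) = v)
    (hG : ∀ v ∈ S, G.Adj v (σ v)) (hF : ∀ e ∈ F, ∃ v ∈ S, e = s(v, σ v)) :
    MatchesOn G S F := by
  refine ⟨{e | ∃ v ∈ S, e = s(v, σ v)}, ⟨?_, ?_⟩, hF, fun v => ⟨?_, ?_⟩⟩
  · rintro _ ⟨v, hv, rfl⟩
    exact hG v hv
  · rintro _ ⟨v, hv, rfl⟩ _ ⟨w, hw, rfl⟩ hne x hx hx'
    apply hne
    simp only [Sym2.mem_iff] at hx hx'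
    rcases hx with rfl | rfl <;> rcases hx' with h | h
    · rw [h]
    · rw [h, hσ w hw, Sym2.eq_swap]
    · rw [← h, hσ v hv, Sym2.eq_swap]
    · rw [← hσ v hv, h, hσ w hw]
  · rintro ⟨_, ⟨w, hw, rfl⟩, h⟩
    rcases Sym2.mem_iff.1 h with rfl | rfl
    exacts [hw, hS w hw]
  · exact fun hv => ⟨_, ⟨v, hv, rfl⟩, Sym2.mem_mk_left _ _⟩

lemma MatchesOn.mono {V : Type*} {G : SimpleGraph V} {S : Set V} {F F' : Set (Sym2 V)}
    (h : MatchesOn G S F) (hF : F' ⊆ F) : MatchesOn G S F' := by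
  obtain ⟨P, hP, hFP, hc⟩ := h
  exact ⟨P, hP, hF.trans hFP, hc⟩

lemma MatchesOn.union {V : Type*} {G : SimpleGraph V} {S S' : Set V} {F F' : Set (Sym2 V)}
    (h : MatchesOn G S F) (h' : MatchesOn G S' F') (hd : Disjoint S S') :
    MatchesOn G (S ∪ S') (F ∪ F') := by
  obtain ⟨P, ⟨hP, hPd⟩, hF, hc⟩ := h
  obtain ⟨P', ⟨hP', hPd'⟩, hF', hc'⟩ := h'
  have hdis {e f v} (he : e ∈ P) (hf : f ∈ P') (hve : v ∈ e) (hvf : v ∈ f) : False :=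
    Set.disjoint_left.1 hd ((hc v).1 ⟨e, he, hve⟩) ((hc' v).1 ⟨f, hf, hvf⟩)
  refine ⟨P ∪ P', ⟨Set.union_subset hP hP', ?_⟩, Set.union_subset_union hF hF', fun v => ?_⟩
  · rintro e (he | he) f (hf | hf) hne v hve hvf
    · exact hPd he hf hne v hve hvf
    · exact hdis he hf hve hvf
    · exact hdis hf he hvf hve
    · exact hPd' he hf hne v hve hvf
  · rw [Set.mem_union, ← hc, ← hc']
    simp only [Set.mem_union, or_and_right, exists_or]

lemma cycleZMod_adj_add_one {n : ℕ} (h : (1 : ZMod n) ≠ 0) (a : ZMod n) :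
    (cycleZMod n).Adj a (a + 1) := by
  simp [cycleZMod, h]

/-- The `i`-th edge of the column `c` of a torus. -/
abbrev columnEdge {m n : ℕ} (i : ZMod m) (c : ZMod n) : Sym2 (ZMod m × ZMod n) :=
  s((i, c), (i + 1, c))

/-- The edge of the row `i` of a torus from the column `c` to the next one. -/
abbrev rowEdge {m n : ℕ} (i : ZMod m) (c : ZMod n) : Sym2 (ZMod m × ZMod n) :=
  s((i, c), (i, c + 1))

lemma eq_columnEdge_or_eq_rowEdge {m n : ℕ} {e : Sym2 (ZMod m × ZMod n)}
    (he : e ∈ (cycleZMod m □ cycleZMod n).edgeSet) :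
    ∃ i c, e = columnEdge i c ∨ e = rowEdge i c := by
  induction e using Sym2.ind with
  | _ v w =>
    obtain ⟨a, b⟩ := v
    obtain ⟨a', b'⟩ := w
    simp only [mem_edgeSet, boxProd_adj, cycleZMod, fromRel_adj] at he
    rcases he with ⟨⟨-, rfl | rfl⟩, rfl⟩ | ⟨⟨-, rfl | rfl⟩, rfl⟩
    · exact ⟨_, _, Or.inl rfl⟩
    · exact ⟨_, _, Or.inl Sym2.eq_swap⟩
    · exact ⟨_, _, Or.inr rfl⟩
    · exact ⟨_, _, Or.inr Sym2.eq_swap⟩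

section Torus

variable {m n : ℕ}

/-- `MatchesOn` for the subgraph of a torus induced by a set of columns. -/
def ColumnsMatch (C : Set (ZMod n)) (F : Set (Sym2 (ZMod m × ZMod n))) : Prop :=
  MatchesOn (cycleZMod m □ cycleZMod n) {v | v.2 ∈ C} F

lemma ColumnsMatch.glue {S C : Set (ZMod n)} {F F' H : Set (Sym2 (ZMod m × ZMod n))}
    (h : ColumnsMatch S F) (h' : ColumnsMatch (C \ S) F') (hS : S ⊆ C) (hH : H ⊆ F ∪ F') :
    ColumnsMatch C H := by
  have := (MatchesOn.union h h' (Set.disjoint_left.2 fun v hv hv' => hv'.2 hv)).mono hH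
  rwa [← Set.ofPred_or, show {v : ZMod m × ZMod n | v.2 ∈ S ∨ v.2 ∈ C \ S} = {v | v.2 ∈ C} by
    ext v
    simp only [Set.mem_ofPred_eq, ← Set.mem_union, Set.union_sdiff_cancel hS]] at this

/-- The perfect matching of an even cycle pairing each `i` of colour `p` with `i + 1`. -/
def alternate (χ : ZMod m →+* ZMod 2) (p : ZMod 2) (i : ZMod m) : ZMod m :=
  if χ i = p then i + 1 else i - 1

lemma alternate_alternate (χ : ZMod m →+* ZMod 2) (p : ZMod 2) (i : ZMod m) :
    alternate χ p (alternate χ p i) = i := by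
  have key : ∀ x p : ZMod 2, (x = p → x + 1 ≠ p) ∧ (x ≠ p → x - 1 = p) := by decide
  by_cases h : χ i = p
  · simp [alternate, h, (key p p).1 rfl]
  · simp [alternate, h, (key _ p).2 h]

lemma alternate_self (χ : ZMod m →+* ZMod 2) (i : ZMod m) : alternate χ (χ i) i = i + 1 := by
  simp [alternate]

lemma exists_alternate_ne (χ : ZMod m →+* ZMod 2) (h2 : (2 : ZMod m) ≠ 0) (i k : ZMod m) :
    ∃ p, alternate χ p i ≠ k := by
  by_contra! h
  have h₁ := h (χ i)
  have h₂ := h (χ i + 1)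
  simp only [alternate, if_true, left_eq_add, one_ne_zero, if_false] at h₁ h₂
  exact h2 (by linear_combination h₁ - h₂)

lemma cycleZMod_adj_alternate (χ : ZMod m →+* ZMod 2) (h1 : (1 : ZMod m) ≠ 0) (p : ZMod 2)
    (i : ZMod m) : (cycleZMod m).Adj i (alternate χ p i) := by
  unfold alternate
  split_ifs
  · exact cycleZMod_adj_add_one h1 i
  · simpa using (cycleZMod_adj_add_one h1 (i - 1)).symm

lemma columnsMatch_columnEdges (χ : ZMod m →+* ZMod 2) (h1 : (1 : ZMod m) ≠ 0)
    (C : Set (ZMod n)) (r : ZMod n → ZMod m) :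
    ColumnsMatch C {e | ∃ c ∈ C, e = columnEdge (r c) c} := by
  refine matchesOn_of_involution (fun v => (alternate χ (χ (r v.2)) v.1, v.2))
    (fun v hv => hv) (fun v _ => by simp [alternate_alternate])
    (fun v _ => boxProd_adj.2 (Or.inl ⟨cycleZMod_adj_alternate χ h1 _ _, rfl⟩)) ?_
  rintro e ⟨c, hc, rfl⟩
  exact ⟨(r c, c), hc, by simp [alternate_self]⟩

lemma columnsMatch_pair_of_dominoes (h1 : (1 : ZMod m) ≠ 0) (h1' : (1 : ZMod n) ≠ 0)
    (D : Set (ZMod m)) (hD : ∀ i ∈ D, i + 1 ∉ D) (c : ZMod n) :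
    ColumnsMatch {c, c + 1} ({e | ∃ i ∈ D, e = columnEdge i c ∨ e = columnEdge i (c + 1)} ∪
      {e | ∃ i, i ∉ D ∧ i - 1 ∉ D ∧ e = rowEdge i c}) := by
  classical
  refine matchesOn_of_involution (fun v => if v.1 ∈ D then (v.1 + 1, v.2) else
    if v.1 - 1 ∈ D then (v.1 - 1, v.2) else if v.2 = c then (v.1, c + 1) else (v.1, c)) ?_ ?_ ?_ ?_
  · rintro ⟨i, k⟩ hk
    dsimp only
    split_ifs <;> simp_all
  · rintro ⟨i, k⟩ (rfl | rfl)
    all_goals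
      by_cases hi : i ∈ D
      · simp [hi, hD i hi]
      · by_cases hi' : i - 1 ∈ D
        · simp [hi, hi']
        · simp [hi, hi', h1']
  · rintro ⟨i, k⟩ hk
    rw [boxProd_adj]
    dsimp only
    split_ifs with h h' h''
    · exact Or.inl ⟨cycleZMod_adj_add_one h1 i, rfl⟩
    · exact Or.inl ⟨by simpa using (cycleZMod_adj_add_one h1 (i - 1)).symm, rfl⟩
    · exact Or.inr ⟨h'' ▸ cycleZMod_adj_add_one h1' k, rfl⟩
    · obtain rfl : k = c + 1 := hk.resolve_left h''
      exact Or.inr ⟨(cycleZMod_adj_add_one h1' c).symm, rfl⟩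
  · rintro e (⟨i, hi, rfl | rfl⟩ | ⟨i, hi, hi', rfl⟩)
    · exact ⟨(i, c), by simp, by simp [hi]⟩
    · exact ⟨(i, c + 1), by simp, by simp [hi]⟩
    · exact ⟨(i, c), by simp, by simp [hi, hi']⟩

lemma columnsMatch_triple_rowEdges (χ : ZMod m →+* ZMod 2) (h1 : (1 : ZMod m) ≠ 0)
    (h2 : (2 : ZMod m) ≠ 0) (h1' : (1 : ZMod n) ≠ 0) (h2' : (2 : ZMod n) ≠ 0)
    {i k : ZMod m} (hik : i ≠ k) (c : ZMod n) :
    ColumnsMatch {c, c + 1, c + 2} {rowEdge i c, rowEdge k (c + 1)} := by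
  classical
  obtain ⟨p, hp⟩ := exists_alternate_ne χ h2 i k
  obtain ⟨τ, hτ, hττ, hadj⟩ : ∃ τ : ZMod m → ZMod m, τ i ≠ k ∧ (∀ x, τ (τ x) = x) ∧
      ∀ x, (cycleZMod m).Adj x (τ x) :=
    ⟨_, hp, alternate_alternate χ p, cycleZMod_adj_alternate χ h1 p⟩
  have hc12 : c + 2 ≠ c + 1 := fun h => h1' (by linear_combination h)
  obtain ⟨A, hA⟩ : ∃ A : Set (ZMod m), A = {i, τ i} := ⟨_, rfl⟩
  obtain ⟨B, hB⟩ : ∃ B : Set (ZMod m), B = {k, τ k} := ⟨_, rfl⟩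
  have closed : ∀ a x, τ x ∈ ({a, τ a} : Set (ZMod m)) ↔ x ∈ ({a, τ a} : Set (ZMod m)) := by
    simp only [Set.mem_insert_iff, Set.mem_singleton_iff]
    grind
  have hτA : ∀ x, τ x ∈ A ↔ x ∈ A := hA ▸ closed i
  have hτB : ∀ x, τ x ∈ B ↔ x ∈ B := hB ▸ closed k
  have hAB : ∀ x ∈ A, x ∉ B := by
    simp only [hA, hB, Set.mem_insert_iff, Set.mem_singleton_iff]
    grind
  have hBA : ∀ x ∈ B, x ∉ A := fun x hx hx' => hAB x hx' hx
  have hadj₁ := cycleZMod_adj_add_one h1' c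
  have hadj₂ : (cycleZMod n).Adj (c + 1) (c + 2) := by
    simpa [add_assoc, one_add_one_eq_two] using cycleZMod_adj_add_one h1' (c + 1)
  refine matchesOn_of_involution (fun v =>
    if v.2 = c then (if v.1 ∈ A then (v.1, c + 1) else (τ v.1, c))
    else if v.2 = c + 1 then
      (if v.1 ∈ A then (v.1, c) else if v.1 ∈ B then (v.1, c + 2) else (τ v.1, c + 1))
    else (if v.1 ∈ B then (v.1, c + 1) else (τ v.1, c + 2))) ?_ ?_ ?_ ?_
  · rintro ⟨x, y⟩ -
    dsimp only
    split_ifs <;> simp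
  · rintro ⟨x, y⟩ (rfl | rfl | rfl)
    all_goals
      by_cases hxA : x ∈ A
      · simp [hxA, hAB x hxA, h1', h2', hc12, hττ, hτB]
      · by_cases hxB : x ∈ B
        · simp [hxA, hxB, h1', h2', hc12, hττ, hτA]
        · simp [hxA, hxB, h1', h2', hc12, hττ, hτA, hτB]
  · rintro ⟨x, y⟩ (rfl | rfl | rfl)
    all_goals
      rw [boxProd_adj]
      by_cases hxA : x ∈ A
      · simp [hxA, hAB x hxA, h1', h2', hc12, hadj, hadj₁, hadj₁.symm]
      · by_cases hxB : x ∈ B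
        · simp [hxA, hxB, h1', h2', hc12, hadj, hadj₂, hadj₂.symm]
        · simp [hxA, hxB, h1', h2', hc12, hadj]
  · have hi : i ∈ A := by simp [hA]
    have hk : k ∈ B := by simp [hB]
    rintro e (rfl | rfl)
    · exact ⟨(i, c), by simp, by simp [hi]⟩
    · exact ⟨(k, c + 1), by simp, by simp [hk, hBA k hk, h1', add_assoc, one_add_one_eq_two]⟩

lemma columnsMatch_columnEdge_pair (χ : ZMod m →+* ZMod 2) (h1 : (1 : ZMod m) ≠ 0)
    {C : Set (ZMod n)} {a b : ZMod n} (ha : a ∈ C) (hb : b ∈ C) (hab : a ≠ b) (i k : ZMod m) :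
    ColumnsMatch C {columnEdge i a, columnEdge k b} := by
  classical
  refine (columnsMatch_columnEdges χ h1 C fun c => if c = a then i else k).mono ?_
  rintro e (rfl | rfl)
  · exact ⟨a, ha, by simp⟩
  · exact ⟨b, hb, by simp [hab.symm]⟩

lemma columnsMatch_columnEdge (χ : ZMod m →+* ZMod 2) (h1 : (1 : ZMod m) ≠ 0)
    {C : Set (ZMod n)} {a : ZMod n} (ha : a ∈ C) (i : ZMod m) :
    ColumnsMatch C {columnEdge i a} := by
  refine (columnsMatch_columnEdges χ h1 C fun _ => i).mono ?_
  rintro e rfl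
  exact ⟨a, ha, rfl⟩

lemma columnsMatch_empty (χ : ZMod m →+* ZMod 2) (h1 : (1 : ZMod m) ≠ 0) (C : Set (ZMod n)) :
    ColumnsMatch C (∅ : Set (Sym2 (ZMod m × ZMod n))) :=
  (columnsMatch_columnEdges χ h1 C fun _ => 0).mono (Set.empty_subset _)

/-- Two edges that coincide or have no common vertex. -/
def EqOrDisjoint {V : Type*} (e f : Sym2 V) : Prop := e = f ∨ ∀ v, v ∈ e → v ∉ f

lemma EqOrDisjoint.symm {V : Type*} {e f : Sym2 V} (h : EqOrDisjoint e f) : EqOrDisjoint f e :=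
  h.imp Eq.symm fun h v hf he => h v he hf

lemma columnsMatch_pair_rowEdge_columnEdge (h1 : (1 : ZMod m) ≠ 0) (h1' : (1 : ZMod n) ≠ 0)
    {c b : ZMod n} (hb : b ∈ ({c, c + 1} : Set (ZMod n))) {i k : ZMod m}
    (hd : EqOrDisjoint (rowEdge i c) (columnEdge k b)) :
    ColumnsMatch {c, c + 1} {rowEdge i c, columnEdge k b} := by
  have hki : i ≠ k ∧ i - 1 ≠ k := by
    rw [ne_eq, ne_eq, sub_eq_iff_eq_add]
    rcases hd with hd | hd
    · simp only [Sym2.eq_iff, Prod.mk.injEq] at hd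
      rcases hd with ⟨⟨-, h⟩, -, h'⟩ | ⟨⟨-, h⟩, -, h'⟩ <;>
        exact absurd (by linear_combination h' - h) h1'
    · have h := hd (i, b) (by rcases hb with rfl | rfl <;> simp)
      simpa using h
  refine (columnsMatch_pair_of_dominoes h1 h1' {k} (by simpa using h1) c).mono ?_
  rintro e (rfl | rfl)
  · exact Or.inr ⟨i, hki.1, hki.2, rfl⟩
  · refine Or.inl ⟨k, rfl, ?_⟩
    rcases hb with rfl | rfl
    exacts [Or.inl rfl, Or.inr rfl]

lemma columnsMatch_pair_rowEdges (h1 : (1 : ZMod m) ≠ 0) (h1' : (1 : ZMod n) ≠ 0)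
    (c : ZMod n) (i k : ZMod m) : ColumnsMatch {c, c + 1} {rowEdge i c, rowEdge k c} := by
  refine (columnsMatch_pair_of_dominoes h1 h1' ∅ (by simp) c).mono ?_
  rintro e (rfl | rfl)
  exacts [Or.inr ⟨i, by simp⟩, Or.inr ⟨k, by simp⟩]

lemma columnsMatch_pair_columnEdges (h1 : (1 : ZMod m) ≠ 0) (h2 : (2 : ZMod m) ≠ 0)
    (h1' : (1 : ZMod n) ≠ 0)
    {c b : ZMod n} (hb : b ∈ ({c, c + 1} : Set (ZMod n))) {i k : ZMod m}
    (hd : EqOrDisjoint (columnEdge i b) (columnEdge k b)) :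
    ColumnsMatch {c, c + 1} {columnEdge i b, columnEdge k b} := by
  have hik : i + 1 ≠ k ∧ k + 1 ≠ i := by
    rcases hd with hd | hd
    · constructor <;> rintro rfl <;> simp [h1] at hd
      · exact h2 (by linear_combination -hd)
      · exact h2 (by linear_combination hd)
    · exact ⟨fun h => hd (i + 1, b) (by simp) (by simp [h]),
        fun h => hd (i, b) (by simp) (by simp [h])⟩
  refine (columnsMatch_pair_of_dominoes h1 h1' {i, k} ?_ c).mono ?_
  · simp only [Set.mem_insert_iff, Set.mem_singleton_iff]
    rintro x (rfl | rfl) <;> simp [h1, hik]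
  · rintro e (rfl | rfl)
    · exact Or.inl ⟨i, by simp, by rcases hb with rfl | rfl <;> simp⟩
    · exact Or.inl ⟨k, by simp, by rcases hb with rfl | rfl <;> simp⟩

lemma columnsMatch_pair (χ : ZMod m →+* ZMod 2) (h1 : (1 : ZMod m) ≠ 0) (h2 : (2 : ZMod m) ≠ 0)
    (h1' : (1 : ZMod n) ≠ 0) (h2' : (2 : ZMod n) ≠ 0) {c : ZMod n} {e f : Sym2 (ZMod m × ZMod n)}
    (he : e ∈ (cycleZMod m □ cycleZMod n).edgeSet) (hf : f ∈ (cycleZMod m □ cycleZMod n).edgeSet)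
    (hec : ∀ v ∈ e, v.2 ∈ ({c, c + 1} : Set (ZMod n)))
    (hfc : ∀ v ∈ f, v.2 ∈ ({c, c + 1} : Set (ZMod n))) (hd : EqOrDisjoint e f) :
    ColumnsMatch {c, c + 1} {e, f} := by
  have hrow {i : ZMod m} {a : ZMod n}
      (h : ∀ v ∈ rowEdge i a, v.2 ∈ ({c, c + 1} : Set (ZMod n))) : a = c := by
    have h₁ := h (i, a) (by simp)
    have h₂ := h (i, a + 1) (by simp)
    simp only [Set.mem_insert_iff, Set.mem_singleton_iff] at h₁ h₂
    grind
  obtain ⟨i, a, rfl | rfl⟩ := eq_columnEdge_or_eq_rowEdge he <;>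
    obtain ⟨k, b, rfl | rfl⟩ := eq_columnEdge_or_eq_rowEdge hf
  · have ha := hec (i, a) (by simp)
    have hb := hfc (k, b) (by simp)
    by_cases hab : a = b
    · subst hab
      exact columnsMatch_pair_columnEdges h1 h2 h1' ha hd
    · exact columnsMatch_columnEdge_pair χ h1 ha hb hab i k
  · obtain rfl := hrow hfc
    rw [Set.pair_comm (columnEdge i a)]
    exact columnsMatch_pair_rowEdge_columnEdge h1 h1' (hec (i, a) (by simp)) hd.symm
  · obtain rfl := hrow hec
    exact columnsMatch_pair_rowEdge_columnEdge h1 h1' (hfc (k, b) (by simp)) hd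
  · obtain rfl := hrow hec
    obtain rfl := hrow hfc
    exact columnsMatch_pair_rowEdges h1 h1' _ i k

lemma columnsMatch_rowEdge_columnEdge (χ : ZMod m →+* ZMod 2) (h1 : (1 : ZMod m) ≠ 0)
    (h1' : (1 : ZMod n) ≠ 0) {C : Set (ZMod n)} {i k : ZMod m} {a b : ZMod n}
    (ha : {a, a + 1} ⊆ C) (hb : b ∈ C) (hd : EqOrDisjoint (rowEdge i a) (columnEdge k b)) :
    ColumnsMatch C {rowEdge i a, columnEdge k b} := by
  by_cases hba : b ∈ ({a, a + 1} : Set (ZMod n))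
  · exact (columnsMatch_pair_rowEdge_columnEdge h1 h1' hba hd).glue
      (columnsMatch_empty χ h1 _) ha (by simp)
  · refine (columnsMatch_pair_rowEdges h1 h1' a i i).glue
      (columnsMatch_columnEdge χ h1 (C := C \ {a, a + 1}) ⟨hb, hba⟩ k) ha ?_
    rintro e (rfl | rfl) <;> simp

lemma columnsMatch_rowEdges (χ : ZMod m →+* ZMod 2) (h1 : (1 : ZMod m) ≠ 0)
    (h2 : (2 : ZMod m) ≠ 0) (h1' : (1 : ZMod n) ≠ 0) (h2' : (2 : ZMod n) ≠ 0)
    {C : Set (ZMod n)} {i k : ZMod m} {a b : ZMod n}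
    (ha : {a, a + 1} ⊆ C) (hb : {b, b + 1} ⊆ C)
    (hd : EqOrDisjoint (rowEdge i a) (rowEdge k b)) :
    ColumnsMatch C {rowEdge i a, rowEdge k b} := by
  have consecutive {i k : ZMod m} {a : ZMod n} (ha : {a, a + 1} ⊆ C)
      (hb : {a + 1, a + 1 + 1} ⊆ C) (hd : EqOrDisjoint (rowEdge i a) (rowEdge k (a + 1))) :
      ColumnsMatch C {rowEdge i a, rowEdge k (a + 1)} := by
    have hik : i ≠ k := by
      rintro rfl
      rcases hd with hd | hd
      · simp [h1', add_assoc, one_add_one_eq_two, h2'] at hd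
      · exact hd (i, a + 1) (by simp) (by simp)
    refine (columnsMatch_triple_rowEdges χ h1 h2 h1' h2' hik a).glue
      (columnsMatch_empty χ h1 _) ?_ (by simp)
    rw [add_assoc, one_add_one_eq_two] at hb
    rintro x (rfl | hx)
    exacts [ha (by simp), hb hx]
  by_cases hab : b = a
  · subst hab
    exact (columnsMatch_pair_rowEdges h1 h1' b i k).glue (columnsMatch_empty χ h1 _) ha (by simp)
  by_cases hab₁ : b = a + 1
  · subst hab₁
    exact consecutive ha hb hd
  by_cases hba₁ : a = b + 1
  · subst hba₁
    rw [Set.pair_comm (rowEdge i _)]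
    exact consecutive hb ha hd.symm
  · refine (columnsMatch_pair_rowEdges h1 h1' a i i).glue (F' := {rowEdge k b})
      ((columnsMatch_pair_rowEdges h1 h1' b k k).glue (columnsMatch_empty χ h1 _) ?_ (by simp))
      ha ?_
    · intro x hx
      refine ⟨hb hx, ?_⟩
      simp only [Set.mem_insert_iff, Set.mem_singleton_iff] at hx ⊢
      grind
    · rintro e (rfl | rfl) <;> simp

lemma columnsMatch_compl_pair (χ : ZMod m →+* ZMod 2) (h1 : (1 : ZMod m) ≠ 0)
    (h2 : (2 : ZMod m) ≠ 0) (h1' : (1 : ZMod n) ≠ 0) (h2' : (2 : ZMod n) ≠ 0)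
    (h3' : (3 : ZMod n) ≠ 0) {j : ZMod n} {e f : Sym2 (ZMod m × ZMod n)}
    (he : e ∈ (cycleZMod m □ cycleZMod n).edgeSet) (hf : f ∈ (cycleZMod m □ cycleZMod n).edgeSet)
    (hej : ∀ v ∈ e, v.2 ∈ ({j, j + 1}ᶜ : Set (ZMod n)))
    (hfj : ∀ v ∈ f, v.2 ∈ ({j, j + 1}ᶜ : Set (ZMod n))) (hd : EqOrDisjoint e f) :
    ColumnsMatch {j, j + 1}ᶜ {e, f} := by
  have hrow {i : ZMod m} {a : ZMod n} (h : ∀ v ∈ rowEdge i a, v.2 ∈ ({j, j + 1}ᶜ : Set (ZMod n))) :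
      {a, a + 1} ⊆ ({j, j + 1}ᶜ : Set (ZMod n)) := by
    rintro x (rfl | rfl)
    exacts [h (i, x) (by simp), h (i, a + 1) (by simp)]
  obtain ⟨i, a, rfl | rfl⟩ := eq_columnEdge_or_eq_rowEdge he <;>
    obtain ⟨k, b, rfl | rfl⟩ := eq_columnEdge_or_eq_rowEdge hf
  · have ha := hej (i, a) (by simp)
    have hb := hfj (k, b) (by simp)
    by_cases hab : a = b
    · subst hab
      obtain ⟨c, hac, hc⟩ : ∃ c, a ∈ ({c, c + 1} : Set (ZMod n)) ∧
          {c, c + 1} ⊆ ({j, j + 1}ᶜ : Set (ZMod n)) := by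
        simp only [Set.mem_compl_iff, Set.mem_insert_iff, Set.mem_singleton_iff, not_or] at ha
        by_cases haj : a = j + 2
        · refine ⟨a, by simp, ?_⟩
          rintro x (rfl | rfl) <;>
            simp only [Set.mem_compl_iff, Set.mem_insert_iff, Set.mem_singleton_iff, not_or] <;>
            grind
        · refine ⟨a - 1, by simp, ?_⟩
          rintro x (rfl | rfl) <;>
            simp only [Set.mem_compl_iff, Set.mem_insert_iff, Set.mem_singleton_iff, not_or] <;>
            grind
      exact (columnsMatch_pair_columnEdges h1 h2 h1' hac hd).glue
        (columnsMatch_empty χ h1 _) hc (by simp)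
    · exact columnsMatch_columnEdge_pair χ h1 ha hb hab i k
  · rw [Set.pair_comm (columnEdge i a)]
    exact columnsMatch_rowEdge_columnEdge χ h1 h1' (hrow hfj) (hej (i, a) (by simp)) hd.symm
  · exact columnsMatch_rowEdge_columnEdge χ h1 h1' (hrow hej) (hfj (k, b) (by simp)) hd
  · exact columnsMatch_rowEdges χ h1 h2 h1' h2' (hrow hej) (hrow hfj) hd

end Torus

lemma natCast_zmod_ne_zero {n k : ℕ} (hk : 0 < k) (hkn : k < n) : (k : ZMod n) ≠ 0 := by
  rw [ne_eq, ZMod.natCast_eq_zero_iff]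
  exact Nat.not_dvd_of_pos_of_lt hk hkn

lemma IsMatchingSet.exists_eq_pair {V : Type*} {G : SimpleGraph V} {M F : Set (Sym2 V)}
    (hM : IsMatchingSet G M) (hF : F ⊆ M) (h : F.ncard = 1 ∨ F.ncard = 2) :
    ∃ e f, e ∈ F ∧ f ∈ F ∧ e ∈ G.edgeSet ∧ f ∈ G.edgeSet ∧ EqOrDisjoint e f ∧ F = {e, f} := by
  obtain ⟨e, f, rfl⟩ : ∃ e f, F = {e, f} := by
    rcases h with h | h
    · obtain ⟨e, rfl⟩ := Set.ncard_eq_one.1 h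
      exact ⟨e, e, by simp⟩
    · obtain ⟨e, f, -, rfl⟩ := Set.ncard_eq_two.1 h
      exact ⟨e, f, rfl⟩
  have he : e ∈ M := hF (by simp)
  have hf : f ∈ M := hF (by simp)
  exact ⟨e, f, by simp, by simp, hM.1 he, hM.1 hf,
    or_iff_not_imp_left.2 fun hne => hM.2 he hf hne, rfl⟩

/-- columns separator lemma for `C_m × C_n` (`m ≥ 6` even, `n ≥ 5` odd).
If for some column index `j` the induced subgraph on columns `j` and `j+1` contains
exactly one or exactly two edges of the 3-matching `M`, and no edge of `M` crosses
between these two columns and the rest of the graph, then `M` extends to a perfect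
matching. -/
theorem cycle_boxProd_cycle_column_separator (m n : ℕ) (hm : 6 ≤ m) (hme : Even m)
    (hn : 5 ≤ n) (hno : Odd n)
    (M : Set (Sym2 (ZMod m × ZMod n)))
    (hM : IsMatchingSet (cycleZMod m □ cycleZMod n) M) (hM3 : M.ncard = 3)
    (j : ZMod n)
    (hcard : {e ∈ M | ∀ v ∈ e, v.2 = j ∨ v.2 = j + 1}.ncard = 1 ∨
      {e ∈ M | ∀ v ∈ e, v.2 = j ∨ v.2 = j + 1}.ncard = 2)
    (hsep : ∀ e ∈ M, (∀ v ∈ e, v.2 = j ∨ v.2 = j + 1) ∨ (∀ v ∈ e, ¬(v.2 = j ∨ v.2 = j + 1))) :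
    ∃ P, IsPerfectMatchingSet (cycleZMod m □ cycleZMod n) P ∧ M ⊆ P := by
  have h1 : (1 : ZMod m) ≠ 0 := by exact_mod_cast natCast_zmod_ne_zero one_pos (by lia)
  have h2 : (2 : ZMod m) ≠ 0 := by exact_mod_cast natCast_zmod_ne_zero two_pos (by lia)
  have h1' : (1 : ZMod n) ≠ 0 := by exact_mod_cast natCast_zmod_ne_zero one_pos (by lia)
  have h2' : (2 : ZMod n) ≠ 0 := by exact_mod_cast natCast_zmod_ne_zero two_pos (by lia)
  have h3' : (3 : ZMod n) ≠ 0 := by exact_mod_cast natCast_zmod_ne_zero three_pos (by lia)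
  let χ : ZMod m →+* ZMod 2 := ZMod.castHom hme.two_dvd (ZMod 2)
  set I := {e ∈ M | ∀ v ∈ e, v.2 = j ∨ v.2 = j + 1}
  have hIM : I ⊆ M := Set.sep_subset _ _
  have hsum : (M \ I).ncard + I.ncard = 3 :=
    hM3 ▸ Set.ncard_sdiff_add_ncard_of_subset hIM (Set.finite_of_ncard_ne_zero (by lia))
  obtain ⟨e, f, he, hf, heG, hfG, hd, hef⟩ := hM.exists_eq_pair hIM hcard
  obtain ⟨e', f', he', hf', heG', hfG', hd', hef'⟩ :=
    hM.exists_eq_pair (Set.sdiff_subset (s := M) (t := I)) (by lia)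
  have hout : ∀ x ∈ M \ I, ∀ v ∈ x, v.2 ∈ ({j, j + 1}ᶜ : Set (ZMod n)) := fun x hx =>
    (hsep x hx.1).resolve_left fun h => hx.2 ⟨hx.1, h⟩
  have hin := columnsMatch_pair χ h1 h2 h1' h2' heG hfG he.2 hf.2 hd
  have hcompl := columnsMatch_compl_pair χ h1 h2 h1' h2' h3' heG' hfG' (hout _ he') (hout _ hf') hd'
  rw [← hef] at hin
  rw [← hef', Set.compl_eq_univ_sdiff] at hcompl
  obtain ⟨P, hP, hMP, hc⟩ := hin.glue hcompl (Set.subset_univ _) (H := M)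
    (Set.union_sdiff_cancel hIM).ge
  exact ⟨P, ⟨hP, fun v => (hc v).2 (Set.mem_univ _)⟩, hMP⟩
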